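/- Let F be a field, q ∈ F with q ≠ 0, and f, g ∈ F[h] with deg f > 1. Then every F-algebra automorphism φ of H_q(f,g) satisfies: φ maps the subalgebra F[h] onto itself (indeed φ(h) = ah + b for some a ∈ F*, b ∈ F), and there exist nonzero scalars λ, μ ∈ F* with φ(x) = λx and φ(y) = μy. -/

import Mathlib

open Polynomial

/-- The three generators `x`, `y`, `h` of a quantum generalized Heisenberg algebra. -/
inductive QGHAGen : Type
  | x : QGHAGen
  | y : QGHAGen
  | h : QGHAGen

/-- The defining relations of the quantum generalized Heisenberg algebra `H_q(f,g)`: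
`h*x = x*f(h)`, `y*h = f(h)*y`, and `y*x - q*(x*y) = g(h)`. -/
inductive QGHARel (F : Type*) [Field F] (q : F) (f g : F[X]) :
    FreeAlgebra F QGHAGen → FreeAlgebra F QGHAGen → Prop
  | hx : QGHARel F q f g
      (FreeAlgebra.ι F QGHAGen.h * FreeAlgebra.ι F QGHAGen.x)
      (FreeAlgebra.ι F QGHAGen.x * aeval (FreeAlgebra.ι F QGHAGen.h) f)
  | yh : QGHARel F q f g
      (FreeAlgebra.ι F QGHAGen.y * FreeAlgebra.ι F QGHAGen.h)
      (aeval (FreeAlgebra.ι F QGHAGen.h) f * FreeAlgebra.ι F QGHAGen.y)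
  | yx : QGHARel F q f g
      (FreeAlgebra.ι F QGHAGen.y * FreeAlgebra.ι F QGHAGen.x)
      (q • (FreeAlgebra.ι F QGHAGen.x * FreeAlgebra.ι F QGHAGen.y)
        + aeval (FreeAlgebra.ι F QGHAGen.h) g)

/-- The quantum generalized Heisenberg algebra `H_q(f,g)`. -/
def QGHA (F : Type*) [Field F] (q : F) (f g : F[X]) : Type _ :=
  RingQuot (QGHARel F q f g)

namespace QGHA

variable {F : Type*} [Field F] (q : F) (f g : F[X])

instance : Ring (QGHA F q f g) :=
  inferInstanceAs (Ring (RingQuot (QGHARel F q f g)))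

instance : Algebra F (QGHA F q f g) :=
  inferInstanceAs (Algebra F (RingQuot (QGHARel F q f g)))

/-- The generator `x` of `H_q(f,g)`. -/
def x : QGHA F q f g :=
  RingQuot.mkAlgHom F (QGHARel F q f g) (FreeAlgebra.ι F QGHAGen.x)

/-- The generator `y` of `H_q(f,g)`. -/
def y : QGHA F q f g :=
  RingQuot.mkAlgHom F (QGHARel F q f g) (FreeAlgebra.ι F QGHAGen.y)

/-- The generator `h` of `H_q(f,g)`. -/
def h : QGHA F q f g :=
  RingQuot.mkAlgHom F (QGHARel F q f g) (FreeAlgebra.ι F QGHAGen.h)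

end QGHA

namespace QGHA

variable {F : Type*} [Field F] {q : F} {f g : F[X]}

section Relations

lemma h_mul_x : h q f g * x q f g = x q f g * aeval (h q f g) f := by
  have := RingQuot.mkAlgHom_rel F (QGHARel.hx (q := q) (f := f) (g := g))
  rw [map_mul, map_mul, ← aeval_algHom_apply] at this
  exact this

lemma y_mul_h : y q f g * h q f g = aeval (h q f g) f * y q f g := by
  have := RingQuot.mkAlgHom_rel F (QGHARel.yh (q := q) (f := f) (g := g))
  rw [map_mul, map_mul, ← aeval_algHom_apply] at this
  exact this

lemma y_mul_x :
    y q f g * x q f g = q • (x q f g * y q f g) + aeval (h q f g) g := by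
  have := RingQuot.mkAlgHom_rel F (QGHARel.yx (q := q) (f := f) (g := g))
  rw [map_add, map_smul, map_mul, map_mul, ← aeval_algHom_apply] at this
  exact this

/-- Induction principle: `H_q(f,g)` is generated by `x`, `y` and `h`. -/
lemma induction_on {P : QGHA F q f g → Prop} (hC : ∀ a, P (algebraMap F _ a))
    (hx : P (x q f g)) (hy : P (y q f g)) (hh : P (h q f g))
    (hmul : ∀ u v, P u → P v → P (u * v)) (hadd : ∀ u v, P u → P v → P (u + v))
    (u : QGHA F q f g) : P u := by
  obtain ⟨w, rfl⟩ := RingQuot.mkAlgHom_surjective F (QGHARel F q f g) u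
  induction w using FreeAlgebra.induction with
  | grade0 a => rw [AlgHom.commutes]; exact hC a
  | grade1 i => cases i <;> assumption
  | mul a b ha hb => rw [map_mul]; exact hmul _ _ ha hb
  | add a b ha hb => rw [map_add]; exact hadd _ _ ha hb

/-- The algebra homomorphism out of `H_q(f,g)` given by images of the generators. -/
noncomputable def lift {A : Type*} [Ring A] [Algebra F A] {X Y H : A}
    (hx : H * X = X * aeval H f) (yh : Y * H = aeval H f * Y)
    (yx : Y * X = q • (X * Y) + aeval H g) : QGHA F q f g →ₐ[F] A :=
  RingQuot.liftAlgHom F ⟨FreeAlgebra.lift F (fun i => QGHAGen.rec X Y H i), by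
    rintro _ _ (_ | _ | _) <;> simpa [← aeval_algHom_apply]⟩

section

variable {A : Type*} [Ring A] [Algebra F A] {X Y H : A}
  (hx : H * X = X * aeval H f) (yh : Y * H = aeval H f * Y)
  (yx : Y * X = q • (X * Y) + aeval H g)

lemma lift_x : lift hx yh yx (x q f g) = X :=
  (RingQuot.liftAlgHom_mkAlgHom_apply ..).trans (FreeAlgebra.lift_ι_apply ..)

lemma lift_y : lift hx yh yx (y q f g) = Y :=
  (RingQuot.liftAlgHom_mkAlgHom_apply ..).trans (FreeAlgebra.lift_ι_apply ..)

lemma lift_h : lift hx yh yx (h q f g) = H :=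
  (RingQuot.liftAlgHom_mkAlgHom_apply ..).trans (FreeAlgebra.lift_ι_apply ..)

end

end Relations

section Iterates

/-- The `i`-th compositional iterate of a polynomial. -/
noncomputable def iter (f : F[X]) (i : ℕ) : F[X] := f.comp^[i] X

lemma iter_zero (f : F[X]) : iter f 0 = X := rfl

lemma iter_succ (f : F[X]) (i : ℕ) : iter f (i + 1) = f.comp (iter f i) :=
  Function.iterate_succ_apply' ..

lemma iter_comp_self (f : F[X]) (i : ℕ) : (iter f i).comp f = f.comp (iter f i) := by
  induction i with
  | zero => simp [iter_zero]
  | succ i ih => rw [iter_succ, comp_assoc, ih]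

lemma natDegree_iter (f : F[X]) (i : ℕ) : (iter f i).natDegree = f.natDegree ^ i := by
  simp [iter, natDegree_iterate_comp]

/-- The polynomial `G_i` with `y * x ^ i = q ^ i • x ^ i * y + x ^ (i - 1) * G_i(h)`. -/
noncomputable def tail (q : F) (f g : F[X]) : ℕ → F[X]
  | 0 => 0
  | i + 1 => q • tail q f g i + g.comp (iter f i)

lemma aeval_h_mul_x_pow (p : F[X]) (i : ℕ) :
    aeval (h q f g) p * x q f g ^ i = x q f g ^ i * aeval (h q f g) (p.comp (iter f i)) := by
  have step (p : F[X]) :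
      aeval (h q f g) p * x q f g = x q f g * aeval (h q f g) (p.comp f) := by
    induction p using Polynomial.induction_on with
    | C a => simpa using Algebra.commutes _ _
    | add p r hp hr => simp only [map_add, add_mul, mul_add, add_comp, hp, hr]
    | monomial n a ih =>
      rw [pow_succ, ← mul_assoc, map_mul, mul_assoc, aeval_X, h_mul_x, ← mul_assoc, ih]
      simp [mul_assoc]
  induction i generalizing p with
  | zero => simp [iter_zero]
  | succ i ih =>
    rw [pow_succ, ← mul_assoc, ih, mul_assoc, step, comp_assoc, iter_comp_self, iter_succ,
      mul_assoc]

lemma y_mul_aeval_h (p : F[X]) :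
    y q f g * aeval (h q f g) p = aeval (h q f g) (p.comp f) * y q f g := by
  induction p using Polynomial.induction_on with
  | C a => simpa using (Algebra.commutes _ _).symm
  | add p r hp hr => simp only [map_add, add_mul, mul_add, add_comp, hp, hr]
  | monomial n a ih =>
    rw [pow_succ, ← mul_assoc, map_mul, ← mul_assoc, ih, mul_assoc, aeval_X, y_mul_h]
    simp [mul_assoc]

lemma y_mul_x_pow_succ (i : ℕ) :
    y q f g * x q f g ^ (i + 1) = q ^ (i + 1) • (x q f g ^ (i + 1) * y q f g) +
      x q f g ^ i * aeval (h q f g) (tail q f g (i + 1)) := by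
  induction i with
  | zero => simp [y_mul_x, tail, iter_zero]
  | succ i ih =>
    rw [pow_succ' _ (i + 1), ← mul_assoc, y_mul_x, add_mul, aeval_h_mul_x_pow, smul_mul_assoc,
      mul_assoc, ih, tail.eq_2 _ _ _ (i + 1)]
    simp only [mul_add, smul_add, map_add, map_smul, mul_smul_comm, smul_smul, ← mul_assoc,
      ← pow_succ', add_assoc]

end Iterates

section Representation

/-- Formal sums of terms `x ^ i * p(h) * y ^ k`, indexed by `(k, i)`. -/
abbrev Normal (F : Type*) [Field F] : Type _ := ℕ × ℕ →₀ F[X]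

/-- Left multiplication by `x` on normal forms. -/
noncomputable def opX : Module.End F (Normal F) :=
  Finsupp.lsum F fun d => Finsupp.lsingle (d.1, d.2 + 1)

/-- Left multiplication by `h` on normal forms. -/
noncomputable def opH (f : F[X]) : Module.End F (Normal F) :=
  Finsupp.lsum F fun d => Finsupp.lsingle d ∘ₗ LinearMap.mulLeft F (iter f d.2)

/-- Left multiplication by `y` on normal forms. -/
noncomputable def opY (q : F) (f g : F[X]) : Module.End F (Normal F) :=
  Finsupp.lsum F fun d =>
    q ^ d.2 • (Finsupp.lsingle (d.1 + 1, d.2) ∘ₗ (aeval f : F[X] →ₐ[F] F[X]).toLinearMap) +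
      Finsupp.lsingle (d.1, d.2 - 1) ∘ₗ LinearMap.mulLeft F (tail q f g d.2)

/-- Right multiplication by `r(h)` on normal forms. -/
noncomputable def opR (f r : F[X]) : Module.End F (Normal F) :=
  Finsupp.lsum F fun d => Finsupp.lsingle d ∘ₗ LinearMap.mulRight F (r.comp (iter f d.1))

lemma opX_single (d : ℕ × ℕ) (p : F[X]) :
    opX (Finsupp.single d p) = Finsupp.single (d.1, d.2 + 1) p := by
  simp [opX]

lemma opH_single (d : ℕ × ℕ) (p : F[X]) :
    opH f (Finsupp.single d p) = Finsupp.single d (iter f d.2 * p) := by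
  simp [opH]

lemma opY_single (d : ℕ × ℕ) (p : F[X]) :
    opY q f g (Finsupp.single d p) = Finsupp.single (d.1 + 1, d.2) (q ^ d.2 • p.comp f) +
      Finsupp.single (d.1, d.2 - 1) (tail q f g d.2 * p) := by
  simp [opY, comp, aeval_def, eval₂_eq_eval_map]

lemma opR_single (r : F[X]) (d : ℕ × ℕ) (p : F[X]) :
    opR f r (Finsupp.single d p) = Finsupp.single d (p * r.comp (iter f d.1)) := by
  simp [opR]

lemma aeval_opH_single (p : F[X]) (d : ℕ × ℕ) (r : F[X]) :
    aeval (opH f) p (Finsupp.single d r) = Finsupp.single d (p.comp (iter f d.2) * r) := by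
  induction p using Polynomial.induction_on generalizing r with
  | C a => simp [Module.algebraMap_end_apply, smul_eq_C_mul]
  | add p s hp hs => simp [hp, hs, add_mul]
  | monomial n a ih =>
    rw [pow_succ, ← mul_assoc, map_mul, aeval_X, Module.End.mul_apply, opH_single, ih]
    simp [mul_assoc]

/-- The representation of `H_q(f,g)` on normal forms by left multiplication. -/
noncomputable def rep (q : F) (f g : F[X]) : QGHA F q f g →ₐ[F] Module.End F (Normal F) :=
  lift (X := opX) (Y := opY q f g) (H := opH f)
    (by
      refine Finsupp.lhom_ext fun d p => ?_
      simp [-Finsupp.single_mul, opX_single, opH_single, aeval_opH_single, iter_succ])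
    (by
      refine Finsupp.lhom_ext fun d p => ?_
      obtain ⟨k, _ | i⟩ := d
      · simp [-Finsupp.single_mul, opH_single, opY_single, aeval_opH_single, tail, iter_zero]
      · simp [-Finsupp.single_mul, opH_single, opY_single, aeval_opH_single,
          iter_comp_self, iter_succ, comp_assoc, mul_assoc, mul_left_comm, mul_comm])
    (by
      refine Finsupp.lhom_ext fun d p => ?_
      obtain ⟨k, _ | i⟩ := d
      · simp [opX_single, opY_single, aeval_opH_single, tail, iter_zero]
      · simp [-Finsupp.single_mul, opX_single, opY_single, aeval_opH_single,
          tail.eq_2 _ _ _ (i + 1), add_mul, smul_smul, ← pow_succ', add_assoc])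

lemma rep_x : rep q f g (x q f g) = opX := lift_x ..
lemma rep_y : rep q f g (y q f g) = opY q f g := lift_y ..
lemma rep_h : rep q f g (h q f g) = opH f := lift_h ..

lemma rep_aeval_h (p : F[X]) : rep q f g (aeval (h q f g) p) = aeval (opH f) p := by
  rw [← aeval_algHom_apply, rep_h]

/-- The element of `H_q(f,g)` represented by a normal form. -/
noncomputable def ofNormal (q : F) (f g : F[X]) : Normal F →ₗ[F] QGHA F q f g :=
  Finsupp.lsum F fun d =>
    LinearMap.mulRight F (y q f g ^ d.1) ∘ₗ LinearMap.mulLeft F (x q f g ^ d.2) ∘ₗ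
      (aeval (h q f g)).toLinearMap

lemma ofNormal_single (d : ℕ × ℕ) (p : F[X]) : ofNormal q f g (Finsupp.single d p) =
    x q f g ^ d.2 * aeval (h q f g) p * y q f g ^ d.1 := by
  simp [ofNormal]

lemma ofNormal_rep (u : QGHA F q f g) (m : Normal F) :
    ofNormal q f g (rep q f g u m) = u * ofNormal q f g m := by
  induction u using QGHA.induction_on generalizing m with
  | hC a => simp [Module.algebraMap_end_apply, Algebra.smul_def]
  | hmul u v hu hv => rw [map_mul, Module.End.mul_apply, hu, hv, mul_assoc]
  | hadd u v hu hv => rw [map_add, LinearMap.add_apply, map_add, hu, hv, add_mul]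
  | hx =>
    induction m using Finsupp.induction_linear with
    | zero => simp
    | add m n hm hn => simp only [map_add, mul_add, hm, hn]
    | single d p =>
      rw [rep_x, opX_single, ofNormal_single, ofNormal_single]
      simp [pow_succ', mul_assoc]
  | hh =>
    induction m using Finsupp.induction_linear with
    | zero => simp
    | add m n hm hn => simp only [map_add, mul_add, hm, hn]
    | single d p =>
      have := aeval_h_mul_x_pow (q := q) (f := f) (g := g) X d.2
      rw [aeval_X, X_comp] at this
      simp only [rep_h, opH_single, ofNormal_single, map_mul, ← mul_assoc, this]
  | hy =>
    induction m using Finsupp.induction_linear with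
    | zero => simp
    | add m n hm hn => simp only [map_add, mul_add, hm, hn]
    | single d p =>
      rw [rep_y, opY_single, map_add, ofNormal_single, ofNormal_single, ofNormal_single]
      obtain ⟨k, _ | i⟩ := d
      · simp [tail, pow_succ', ← mul_assoc, y_mul_aeval_h]
      · simp only [← mul_assoc, y_mul_x_pow_succ, add_mul, smul_mul_assoc]
        rw [mul_assoc _ (y q f g), y_mul_aeval_h]
        simp [mul_assoc, pow_succ']

/-- The normal form of an element of `H_q(f,g)`. -/
noncomputable def coeffs (q : F) (f g : F[X]) : QGHA F q f g →ₗ[F] Normal F :=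
  LinearMap.applyₗ (Finsupp.single 0 1) ∘ₗ (rep q f g).toLinearMap

lemma coeffs_apply (u : QGHA F q f g) : coeffs q f g u = rep q f g u (Finsupp.single 0 1) := rfl

lemma ofNormal_coeffs (u : QGHA F q f g) : ofNormal q f g (coeffs q f g u) = u := by
  rw [coeffs_apply, ofNormal_rep, ofNormal_single]; simp

lemma coeffs_injective : Function.Injective (coeffs q f g) :=
  Function.LeftInverse.injective ofNormal_coeffs

lemma coeffs_mul (u v : QGHA F q f g) :
    coeffs q f g (u * v) = rep q f g u (coeffs q f g v) := by
  simp [coeffs_apply]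

lemma coeffs_aeval_h (p : F[X]) :
    coeffs q f g (aeval (h q f g) p) = Finsupp.single 0 p := by
  simp [coeffs_apply, rep_aeval_h, aeval_opH_single, iter_zero]

lemma aeval_h_injective : Function.Injective (aeval (h q f g) : F[X] →ₐ[F] QGHA F q f g) := by
  intro p r hpr
  apply Finsupp.single_injective (0 : ℕ × ℕ)
  rw [← coeffs_aeval_h (q := q) (f := f) (g := g), hpr, coeffs_aeval_h]

lemma eq_sum (u : QGHA F q f g) : u = ∑ d ∈ (coeffs q f g u).support,
    x q f g ^ d.2 * aeval (h q f g) (coeffs q f g u d) * y q f g ^ d.1 := by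
  conv_lhs => rw [← ofNormal_coeffs u]
  simp [ofNormal, Finsupp.sum]

lemma rep_opR (r : F[X]) (u : QGHA F q f g) (m : Normal F) :
    rep q f g u (opR f r m) = opR f r (rep q f g u m) := by
  induction u using QGHA.induction_on generalizing m with
  | hC a => simp [Module.algebraMap_end_apply]
  | hmul u v hu hv => simp [hu, hv]
  | hadd u v hu hv => simp [hu, hv]
  | hx =>
    induction m using Finsupp.induction_linear with
    | zero => simp
    | add m n hm hn => simp only [map_add, hm, hn]
    | single d p => simp [-Finsupp.single_mul, rep_x, opX_single, opR_single]
  | hh =>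
    induction m using Finsupp.induction_linear with
    | zero => simp
    | add m n hm hn => simp only [map_add, hm, hn]
    | single d p => simp [-Finsupp.single_mul, rep_h, opH_single, opR_single, mul_assoc]
  | hy =>
    induction m using Finsupp.induction_linear with
    | zero => simp
    | add m n hm hn => simp only [map_add, hm, hn]
    | single d p =>
      simp [-Finsupp.single_mul, rep_y, opY_single, opR_single, mul_assoc, comp_assoc,
        iter_comp_self, iter_succ]

lemma opR_apply (r : F[X]) (m : Normal F) (d : ℕ × ℕ) :
    opR f r m d = m d * r.comp (iter f d.1) := by
  induction m using Finsupp.induction_linear with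
  | zero => simp
  | add m n hm hn => simp [hm, hn, add_mul]
  | single e p =>
    rw [opR_single]
    by_cases hed : e = d
    · simp [hed]
    · simp [hed]

lemma aeval_opH_apply (p : F[X]) (m : Normal F) (d : ℕ × ℕ) :
    aeval (opH f) p m d = p.comp (iter f d.2) * m d := by
  induction m using Finsupp.induction_linear with
  | zero => simp
  | add m n hm hn => simp [hm, hn, mul_add]
  | single e r =>
    rw [aeval_opH_single]
    by_cases hed : e = d
    · simp [hed]
    · simp [hed]

lemma opX_apply_zero (m : Normal F) (k : ℕ) : opX m (k, 0) = 0 := by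
  induction m using Finsupp.induction_linear with
  | zero => simp
  | add m n hm hn => simp [hm, hn]
  | single e r => simp [opX_single]

lemma opX_apply_succ (m : Normal F) (k i : ℕ) : opX m (k, i + 1) = m (k, i) := by
  induction m using Finsupp.induction_linear with
  | zero => simp
  | add m n hm hn => simp [hm, hn]
  | single e r => simp [opX_single, Finsupp.single_apply, Prod.ext_iff]

lemma opY_apply_zero (m : Normal F) (i : ℕ) :
    opY q f g m (0, i) = tail q f g (i + 1) * m (0, i + 1) := by
  induction m using Finsupp.induction_linear with
  | zero => simp
  | add m n hm hn => simp [hm, hn, mul_add]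
  | single e r =>
    obtain ⟨k, _ | j⟩ := e
    · simp [opY_single, tail]
    · simp only [opY_single, Finsupp.add_apply, Finsupp.single_apply, Prod.ext_iff]
      by_cases hij : j = i <;> simp [hij]

lemma opY_apply_succ (m : Normal F) (k i : ℕ) :
    opY q f g m (k + 1, i) =
      q ^ i • (m (k, i)).comp f + tail q f g (i + 1) * m (k + 1, i + 1) := by
  induction m using Finsupp.induction_linear with
  | zero => simp
  | add m n hm hn => simp only [map_add, Finsupp.add_apply, hm, hn, add_comp, smul_add]; ring
  | single e r =>
    obtain ⟨l, j⟩ := e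
    simp only [opY_single, Finsupp.add_apply, Finsupp.single_apply, Prod.ext_iff]
    congr 1
    · by_cases hij : j = i <;> by_cases hkl : l = k <;> simp [hij, hkl]
    · obtain _ | j := j
      · simp [tail]
      · by_cases hij : j = i <;> simp [hij]

lemma coeffs_aeval_h_mul (p : F[X]) (u : QGHA F q f g) (d : ℕ × ℕ) :
    coeffs q f g (aeval (h q f g) p * u) d = p.comp (iter f d.2) * coeffs q f g u d := by
  rw [coeffs_mul, rep_aeval_h, aeval_opH_apply]

lemma coeffs_mul_aeval_h (u : QGHA F q f g) (r : F[X]) (d : ℕ × ℕ) :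
    coeffs q f g (u * aeval (h q f g) r) d = coeffs q f g u d * r.comp (iter f d.1) := by
  have : Finsupp.single 0 r = opR f r (Finsupp.single 0 1) := by simp [opR_single, iter_zero]
  rw [coeffs_mul, coeffs_aeval_h, this, rep_opR, ← coeffs_apply, opR_apply]

end Representation

section LeadingTerm

/-- The formal sum `m` has its leading term at `d`, for the lexicographic order on `(k, i)`. -/
def IsLead (m : Normal F) (d : ℕ × ℕ) : Prop :=
  m d ≠ 0 ∧ ∀ e, toLex d < toLex e → m e = 0

lemma exists_isLead {m : Normal F} (hm : m ≠ 0) : ∃ d, IsLead m d := by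
  obtain ⟨d, hd, hmax⟩ := m.support.exists_max_image toLex (Finsupp.support_nonempty_iff.2 hm)
  refine ⟨d, Finsupp.mem_support_iff.1 hd, fun e he => ?_⟩
  by_contra hne
  exact (hmax e (Finsupp.mem_support_iff.2 hne)).not_gt he

lemma IsLead.unique {m : Normal F} {d e : ℕ × ℕ} (hd : IsLead m d) (he : IsLead m e) :
    d = e := by
  rcases lt_trichotomy (toLex d) (toLex e) with hlt | heq | hgt
  · exact absurd (hd.2 e hlt) he.1
  · exact toLex.injective heq
  · exact absurd (he.2 d hgt) hd.1

lemma IsLead.ne_zero {m : Normal F} {d : ℕ × ℕ} (hd : IsLead m d) : m ≠ 0 := by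
  rintro rfl
  exact hd.1 rfl

lemma isLead_single_zero {p : F[X]} (hp : p ≠ 0) :
    IsLead (Finsupp.single (0 : ℕ × ℕ) p) 0 := by
  refine ⟨by simpa, fun e he => Finsupp.single_eq_of_ne ?_⟩
  rintro rfl
  exact lt_irrefl _ he

lemma IsLead.eq_single {m : Normal F} (hm : IsLead m 0) : m = Finsupp.single 0 (m 0) := by
  ext1 e
  by_cases he : e = 0
  · simp [he]
  · rw [Finsupp.single_eq_of_ne he, hm.2]
    obtain ⟨k, i⟩ := e
    rw [Prod.Lex.toLex_lt_toLex]
    simp only [Prod.ext_iff, Prod.fst_zero, Prod.snd_zero] at he ⊢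
    omega

lemma IsLead.sum {ι : Type*} {s : Finset ι} {m : ι → Normal F} {a : ι} {D : ℕ × ℕ}
    (ha : a ∈ s) (hlead : IsLead (m a) D)
    (hlow : ∀ b ∈ s, b ≠ a → ∀ c, toLex D ≤ toLex c → m b c = 0) :
    IsLead (∑ b ∈ s, m b) D := by
  have key (c) (hc : toLex D ≤ toLex c) : (∑ b ∈ s, m b) c = m a c := by
    rw [Finsupp.finsetSum_apply]
    exact Finset.sum_eq_single_of_mem a ha fun b hb hba => hlow b hb hba c hc
  refine ⟨?_, fun e he => ?_⟩
  · rw [key D le_rfl]; exact hlead.1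
  · rw [key e he.le]; exact hlead.2 e he

lemma comp_ne_zero_of_natDegree_pos {p r : F[X]} (hp : p ≠ 0) (hr : 0 < r.natDegree) :
    p.comp r ≠ 0 := by
  intro hpr
  rcases comp_eq_zero_iff.1 hpr with h0 | ⟨-, h0⟩
  · exact hp h0
  · rw [h0, natDegree_C] at hr
    exact lt_irrefl _ hr

lemma IsLead.opX {m : Normal F} {k i : ℕ} (hm : IsLead m (k, i)) :
    IsLead (opX m) (k, i + 1) := by
  refine ⟨by simpa [opX_apply_succ] using hm.1, ?_⟩
  rintro ⟨l, _ | j⟩ hlt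
  · exact opX_apply_zero ..
  · rw [opX_apply_succ]
    apply hm.2
    rw [Prod.Lex.toLex_lt_toLex] at hlt ⊢
    dsimp only at hlt ⊢
    omega

lemma IsLead.opY (hq : q ≠ 0) (hf : 0 < f.natDegree) {m : Normal F} {k i : ℕ}
    (hm : IsLead m (k, i)) : IsLead (opY q f g m) (k + 1, i) := by
  have hvanish (l j) (hlt : k < l) : m (l, j) = 0 :=
    hm.2 _ (Prod.Lex.toLex_lt_toLex.2 (Or.inl hlt))
  refine ⟨?_, ?_⟩
  · rw [opY_apply_succ, hvanish _ _ k.lt_succ_self, mul_zero, add_zero]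
    exact smul_ne_zero (pow_ne_zero _ hq) (comp_ne_zero_of_natDegree_pos hm.1 hf)
  · rintro ⟨_ | l, j⟩ hlt <;> rw [Prod.Lex.toLex_lt_toLex] at hlt <;> dsimp only at hlt
    · omega
    · rw [opY_apply_succ, hvanish (l + 1) _ (by omega), hm.2 (l, j)]
      · simp
      · rw [Prod.Lex.toLex_lt_toLex]
        dsimp only
        omega

lemma IsLead.aeval_opH (hf : 0 < f.natDegree) {p : F[X]} (hp : p ≠ 0) {m : Normal F}
    {d : ℕ × ℕ} (hm : IsLead m d) : IsLead (aeval (opH f) p m) d := by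
  refine ⟨?_, fun e he => ?_⟩
  · rw [aeval_opH_apply]
    refine mul_ne_zero (comp_ne_zero_of_natDegree_pos hp ?_) hm.1
    rw [natDegree_iter]
    positivity
  · rw [aeval_opH_apply, hm.2 e he, mul_zero]

lemma IsLead.rep_term (hq : q ≠ 0) (hf : 0 < f.natDegree) {p : F[X]} (hp : p ≠ 0)
    {m : Normal F} {e : ℕ × ℕ} (hm : IsLead m e) (d : ℕ × ℕ) :
    IsLead (rep q f g (x q f g ^ d.2 * aeval (h q f g) p * y q f g ^ d.1) m) (d + e) := by
  obtain ⟨k, i⟩ := d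
  obtain ⟨l, j⟩ := e
  have hY (k : ℕ) : IsLead ((QGHA.opY q f g ^ k) m) (l + k, j) := by
    induction k with
    | zero => simpa using hm
    | succ k ih => rw [pow_succ', Module.End.mul_apply]; exact ih.opY hq hf
  have hX (i : ℕ) {m' : Normal F} {k' : ℕ} (hm' : IsLead m' (k', j)) :
      IsLead ((QGHA.opX ^ i) m') (k', j + i) := by
    induction i with
    | zero => simpa using hm'
    | succ i ih => rw [pow_succ', Module.End.mul_apply]; exact ih.opX
  simp only [map_mul, map_pow, rep_x, rep_y, rep_aeval_h, Module.End.mul_apply]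
  rw [Prod.mk_add_mk, add_comm k, add_comm i]
  exact hX i ((hY k).aeval_opH hf hp)

/-- Leading exponents are additive under multiplication. -/
lemma IsLead.mul (hq : q ≠ 0) (hf : 0 < f.natDegree) {u v : QGHA F q f g} {d e : ℕ × ℕ}
    (hu : IsLead (coeffs q f g u) d) (hv : IsLead (coeffs q f g v) e) :
    IsLead (coeffs q f g (u * v)) (d + e) := by
  have hsum := congrArg (fun w => rep q f g w (coeffs q f g v)) (eq_sum u)
  simp only [map_sum, LinearMap.sum_apply] at hsum
  rw [coeffs_mul, hsum]
  have hterm (b) (hb : b ∈ (coeffs q f g u).support) :=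
    hv.rep_term (g := g) hq hf (Finsupp.mem_support_iff.1 hb) b
  have hd := Finsupp.mem_support_iff.2 hu.1
  refine IsLead.sum hd (hterm d hd) fun b hb hbd c hc => (hterm b hb).2 c (lt_of_lt_of_le ?_ hc)
  have hlt : toLex b < toLex d := by
    refine lt_of_le_of_ne (not_lt.1 fun hlt => ?_) (toLex.injective.ne hbd)
    exact Finsupp.mem_support_iff.1 hb (hu.2 b hlt)
  rw [Prod.Lex.toLex_lt_toLex] at hlt ⊢
  simp only [Prod.fst_add, Prod.snd_add]
  omega

lemma isLead_coeffs_one : IsLead (coeffs q f g 1) 0 := by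
  rw [← map_one (aeval (R := F) (h q f g)), coeffs_aeval_h]
  exact isLead_single_zero one_ne_zero

lemma IsLead.pow (hq : q ≠ 0) (hf : 0 < f.natDegree) {u : QGHA F q f g} {d : ℕ × ℕ}
    (hu : IsLead (coeffs q f g u) d) (n : ℕ) : IsLead (coeffs q f g (u ^ n)) (n • d) := by
  induction n with
  | zero => simpa using isLead_coeffs_one
  | succ n ih => rw [pow_succ, succ_nsmul]; exact ih.mul hq hf hu

lemma IsLead.smul {m : Normal F} {d : ℕ × ℕ} (hm : IsLead m d) {c : F} (hc : c ≠ 0) :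
    IsLead (c • m) d :=
  ⟨smul_ne_zero hc hm.1, fun e he => by simp [hm.2 e he]⟩

lemma IsLead.aeval (hq : q ≠ 0) (hf : 0 < f.natDegree) {u : QGHA F q f g} {d : ℕ × ℕ}
    (hu : IsLead (coeffs q f g u) d) (hd : d ≠ 0) {p : F[X]} (hp : p ≠ 0) :
    IsLead (coeffs q f g (aeval u p)) (p.natDegree • d) := by
  rw [aeval_eq_sum_range, map_sum]
  refine IsLead.sum (Finset.self_mem_range_succ _) ?_ fun n hn hne c hc => ?_
  · rw [map_smul]
    exact (hu.pow hq hf _).smul (leadingCoeff_ne_zero.2 hp)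
  · rw [map_smul, Finsupp.smul_apply, (hu.pow hq hf n).2 c (lt_of_lt_of_le ?_ hc), smul_zero]
    have hlt : n < p.natDegree := by grind
    obtain ⟨k, i⟩ := d
    rw [Prod.Lex.toLex_lt_toLex]
    simp only [Prod.smul_fst, Prod.smul_snd, smul_eq_mul]
    rcases Nat.eq_zero_or_pos k with rfl | hk
    · have hi : 0 < i := Nat.pos_of_ne_zero fun h0 => hd (by simp [h0])
      exact Or.inr ⟨by simp, Nat.mul_lt_mul_of_pos_right hlt hi⟩
    · exact Or.inl (Nat.mul_lt_mul_of_pos_right hlt hk)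

lemma coeffs_ne_zero {u : QGHA F q f g} (hu : u ≠ 0) : coeffs q f g u ≠ 0 :=
  (map_ne_zero_iff _ coeffs_injective).2 hu

lemma noZeroDivisors (hq : q ≠ 0) (hf : 0 < f.natDegree) : NoZeroDivisors (QGHA F q f g) where
  eq_zero_or_eq_zero_of_mul_eq_zero {u v} huv := by
    by_contra! hne
    obtain ⟨d, hd⟩ := exists_isLead (coeffs_ne_zero hne.1)
    obtain ⟨e, he⟩ := exists_isLead (coeffs_ne_zero hne.2)
    exact (hd.mul hq hf he).ne_zero (by rw [huv, map_zero])

lemma eq_aeval_h_of_isLead {u : QGHA F q f g} (hu : IsLead (coeffs q f g u) 0) :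
    ∃ p : F[X], u = aeval (h q f g) p :=
  ⟨coeffs q f g u 0, coeffs_injective <| by rw [coeffs_aeval_h]; exact hu.eq_single⟩

lemma h_ne_zero : h q f g ≠ 0 := by
  intro h0
  have := aeval_h_injective (q := q) (f := f) (g := g) (a₁ := X) (a₂ := 0) (by simp [h0])
  exact X_ne_zero this

lemma x_ne_zero : x q f g ≠ 0 := by
  intro h0
  have := coeffs_apply (x q f g)
  rw [rep_x, opX_single, h0, map_zero] at this
  exact one_ne_zero (Finsupp.single_eq_zero.1 this.symm)

lemma y_ne_zero : y q f g ≠ 0 := by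
  intro h0
  have := DFunLike.congr_fun (coeffs_apply (y q f g)) ((1 : ℕ), (0 : ℕ))
  rw [rep_y, opY_apply_succ, h0, map_zero] at this
  simp [Finsupp.single_apply, Prod.ext_iff] at this

/-- Elements that satisfy the commutation relation of `h` and `x` lie in `F[h]`. -/
lemma exists_eq_aeval_h_of_mul_eq (hq : q ≠ 0) (hf : 1 < f.natDegree) {u v : QGHA F q f g}
    (hu : u ≠ 0) (hv : v ≠ 0) (huv : u * v = v * aeval u f) :
    ∃ p : F[X], u = aeval (h q f g) p := by
  have hf0 : 0 < f.natDegree := by omega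
  obtain ⟨d, hd⟩ := exists_isLead (coeffs_ne_zero hu)
  obtain ⟨e, he⟩ := exists_isLead (coeffs_ne_zero hv)
  suffices d = 0 by subst this; exact eq_aeval_h_of_isLead hd
  by_contra hd0
  have hlead := (hd.mul hq hf0 he).unique <|
    huv ▸ he.mul hq hf0 (hd.aeval hq hf0 hd0 (ne_zero_of_natDegree_gt hf))
  rw [add_comm, add_left_cancel_iff] at hlead
  apply hd0
  obtain ⟨k, i⟩ := d
  simp only [Prod.ext_iff, Prod.smul_fst, Prod.smul_snd, smul_eq_mul, Prod.fst_zero,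
    Prod.snd_zero] at hlead ⊢
  constructor <;> nlinarith

lemma exists_eq_algebraMap_of_mul_eq_one (hq : q ≠ 0) (hf : 0 < f.natDegree)
    {u v : QGHA F q f g} (huv : u * v = 1) : ∃ c : F, c ≠ 0 ∧ u = algebraMap F _ c := by
  have h1 : (1 : QGHA F q f g) ≠ 0 := fun h1 =>
    h_ne_zero (q := q) (f := f) (g := g) (by rw [← mul_one (h q f g), h1, mul_zero])
  have hu : u ≠ 0 := by rintro rfl; exact h1 (by rw [← huv, zero_mul])
  have hv : v ≠ 0 := by rintro rfl; exact h1 (by rw [← huv, mul_zero])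
  obtain ⟨d, hd⟩ := exists_isLead (coeffs_ne_zero hu)
  obtain ⟨e, he⟩ := exists_isLead (coeffs_ne_zero hv)
  have hde := (hd.mul hq hf he).unique (huv ▸ isLead_coeffs_one)
  obtain ⟨rfl, rfl⟩ := add_eq_zero.1 hde
  obtain ⟨p, rfl⟩ := eq_aeval_h_of_isLead hd
  obtain ⟨r, rfl⟩ := eq_aeval_h_of_isLead he
  rw [← map_mul, ← map_one (aeval (R := F) (h q f g))] at huv
  obtain ⟨c, hc, rfl⟩ := Polynomial.isUnit_iff.1 (IsUnit.of_mul_eq_one _ (aeval_h_injective huv))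
  exact ⟨c, hc.ne_zero, aeval_C ..⟩

end LeadingTerm

section Automorphisms

lemma algEquiv_h_eq_aeval (hq : q ≠ 0) (hf : 1 < f.natDegree)
    (φ : QGHA F q f g ≃ₐ[F] QGHA F q f g) :
    ∃ p : F[X], p.natDegree = 1 ∧ φ (h q f g) = aeval (h q f g) p := by
  have key (ψ : QGHA F q f g ≃ₐ[F] QGHA F q f g) :
      ∃ p : F[X], ψ (h q f g) = aeval (h q f g) p := by
    refine exists_eq_aeval_h_of_mul_eq hq hf (v := ψ (x q f g))
      ((map_ne_zero_iff _ ψ.injective).2 h_ne_zero)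
      ((map_ne_zero_iff _ ψ.injective).2 x_ne_zero) ?_
    rw [← map_mul, h_mul_x, map_mul, aeval_algHom_apply]
  obtain ⟨p, hp⟩ := key φ
  obtain ⟨r, hr⟩ := key φ.symm
  refine ⟨p, ?_, hp⟩
  have hcomp : r.comp p = X := by
    apply aeval_h_injective (q := q) (f := f) (g := g)
    rw [aeval_comp, ← hp, aeval_algHom_apply, ← hr, AlgEquiv.apply_symm_apply, aeval_X]
  have := congrArg natDegree hcomp
  rw [natDegree_comp, natDegree_X] at this
  exact Nat.eq_one_of_mul_eq_one_left this

lemma exists_eq_x_mul (hf : 1 < f.natDegree) {p : F[X]} (hp : p.natDegree = 1)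
    {u : QGHA F q f g}
    (hu : aeval (h q f g) p * u = u * aeval (aeval (h q f g) p) f) :
    ∃ w, u = x q f g * w := by
  have hexp (d) (hd : d ∈ (coeffs q f g u).support) : d.2 = d.1 + 1 := by
    have hc := Finsupp.mem_support_iff.1 hd
    have := congrArg (fun v => coeffs q f g v d) hu
    simp only [← aeval_comp, coeffs_aeval_h_mul, coeffs_mul_aeval_h] at this
    rw [mul_comm] at this
    have := congrArg natDegree (mul_left_cancel₀ hc this)
    simp only [natDegree_comp, natDegree_iter, hp, one_mul, mul_one, ← pow_succ'] at this
    exact Nat.pow_right_injective hf this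
  rw [eq_sum u]
  refine ⟨_, (Finset.sum_congr rfl fun d hd => ?_).trans (Finset.mul_sum _
    (fun d => x q f g ^ d.1 * aeval (h q f g) (coeffs q f g u d) * y q f g ^ d.1) _).symm⟩
  rw [hexp d hd, pow_succ']
  simp only [mul_assoc]

lemma exists_eq_mul_y (hf : 1 < f.natDegree) {p : F[X]} (hp : p.natDegree = 1)
    {u : QGHA F q f g}
    (hu : u * aeval (h q f g) p = aeval (aeval (h q f g) p) f * u) :
    ∃ w, u = w * y q f g := by
  have hexp (d) (hd : d ∈ (coeffs q f g u).support) : d.1 = d.2 + 1 := by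
    have hc := Finsupp.mem_support_iff.1 hd
    have := congrArg (fun v => coeffs q f g v d) hu
    simp only [← aeval_comp, coeffs_aeval_h_mul, coeffs_mul_aeval_h] at this
    rw [mul_comm] at this
    have := congrArg natDegree (mul_right_cancel₀ hc this)
    simp only [natDegree_comp, natDegree_iter, hp, one_mul, mul_one, ← pow_succ'] at this
    exact Nat.pow_right_injective hf this
  rw [eq_sum u]
  refine ⟨_, (Finset.sum_congr rfl fun d hd => ?_).trans (Finset.sum_mul _
    (fun d => x q f g ^ d.2 * aeval (h q f g) (coeffs q f g u d) * y q f g ^ d.2) _).symm⟩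
  rw [hexp d hd, pow_succ]
  simp only [mul_assoc]

lemma algEquiv_x_eq_smul (hq : q ≠ 0) (hf : 1 < f.natDegree)
    (φ : QGHA F q f g ≃ₐ[F] QGHA F q f g) :
    ∃ c : F, c ≠ 0 ∧ φ (x q f g) = c • x q f g := by
  have key (ψ : QGHA F q f g ≃ₐ[F] QGHA F q f g) : ∃ w, ψ (x q f g) = x q f g * w := by
    obtain ⟨p, hp, hψ⟩ := algEquiv_h_eq_aeval hq hf ψ
    refine exists_eq_x_mul hf hp ?_
    rw [← hψ, ← map_mul, h_mul_x, map_mul, aeval_algHom_apply]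
  obtain ⟨w, hw⟩ := key φ
  obtain ⟨w', hw'⟩ := key φ.symm
  have := noZeroDivisors (g := g) hq (by omega : 0 < f.natDegree)
  have h1 : w * φ w' = 1 := by
    apply mul_left_cancel₀ (x_ne_zero (q := q) (f := f) (g := g))
    rw [← mul_assoc, ← hw, ← map_mul, ← hw', AlgEquiv.apply_symm_apply, mul_one]
  obtain ⟨c, hc, rfl⟩ := exists_eq_algebraMap_of_mul_eq_one hq (by omega) h1
  exact ⟨c, hc, by rw [hw, Algebra.smul_def, Algebra.commutes]⟩

lemma algEquiv_y_eq_smul (hq : q ≠ 0) (hf : 1 < f.natDegree)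
    (φ : QGHA F q f g ≃ₐ[F] QGHA F q f g) :
    ∃ c : F, c ≠ 0 ∧ φ (y q f g) = c • y q f g := by
  have key (ψ : QGHA F q f g ≃ₐ[F] QGHA F q f g) : ∃ w, ψ (y q f g) = w * y q f g := by
    obtain ⟨p, hp, hψ⟩ := algEquiv_h_eq_aeval hq hf ψ
    refine exists_eq_mul_y hf hp ?_
    rw [← hψ, ← map_mul, y_mul_h, map_mul, aeval_algHom_apply]
  obtain ⟨w, hw⟩ := key φ
  obtain ⟨w', hw'⟩ := key φ.symm
  have := noZeroDivisors (g := g) hq (by omega : 0 < f.natDegree)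
  have h1 : φ w' * w = 1 := by
    apply mul_right_cancel₀ (y_ne_zero (q := q) (f := f) (g := g))
    rw [mul_assoc, ← hw, ← map_mul, ← hw', AlgEquiv.apply_symm_apply, one_mul]
  have h2 : w * φ w' = 1 := by
    have hw0 : w ≠ 0 := by
      rintro rfl
      exact y_ne_zero (φ.injective (by rw [hw, zero_mul, map_zero]))
    apply mul_right_cancel₀ hw0
    rw [mul_assoc, h1, mul_one, one_mul]
  obtain ⟨c, hc, rfl⟩ := exists_eq_algebraMap_of_mul_eq_one hq (by omega) h2
  exact ⟨c, hc, by rw [hw, Algebra.smul_def]⟩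

lemma adjoin_smul_h_add {a : F} (ha : a ≠ 0) (b : F) :
    Algebra.adjoin F {a • h q f g + algebraMap F (QGHA F q f g) b} = Algebra.adjoin F {h q f g} := by
  apply le_antisymm <;> refine Algebra.adjoin_le (Set.singleton_subset_iff.2 ?_)
  · exact add_mem (Subalgebra.smul_mem _ (Algebra.self_mem_adjoin_singleton F _) a)
      (Subalgebra.algebraMap_mem _ b)
  · have := Subalgebra.smul_mem _ (sub_mem (Algebra.self_mem_adjoin_singleton F
      (a • h q f g + algebraMap F (QGHA F q f g) b)) (Subalgebra.algebraMap_mem _ b)) a⁻¹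
    rwa [add_sub_cancel_right, smul_smul, inv_mul_cancel₀ ha, one_smul] at this

end Automorphisms

end QGHA

/-- If `q ≠ 0` and `deg f > 1`, then every `F`-algebra automorphism `φ`
of `H_q(f,g)` maps the subalgebra `F[h]` onto itself — indeed `φ(h) = a·h + b` with
`a ∈ F*`, `b ∈ F` — and `x` and `y` are eigenvectors: `φ(x) = λ·x` and `φ(y) = μ·y` for
some `λ, μ ∈ F*`. -/
theorem qgha_aut_structure {F : Type*} [Field F] (q : F) (f g : F[X])
    (hq : q ≠ 0) (hf : 1 < f.degree)
    (φ : QGHA F q f g ≃ₐ[F] QGHA F q f g) :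
    (Algebra.adjoin F {QGHA.h q f g}).map (φ : QGHA F q f g →ₐ[F] QGHA F q f g) =
      Algebra.adjoin F {QGHA.h q f g} ∧
    (∃ a b : F, a ≠ 0 ∧ φ (QGHA.h q f g) = a • QGHA.h q f g + algebraMap F _ b) ∧
    (∃ lam mu : F, lam ≠ 0 ∧ mu ≠ 0 ∧
      φ (QGHA.x q f g) = lam • QGHA.x q f g ∧ φ (QGHA.y q f g) = mu • QGHA.y q f g) := by
  have hf' : 1 < f.natDegree :=
    not_le.1 fun hle => hf.not_ge (degree_le_of_natDegree_le hle)
  obtain ⟨p, hp, hφ⟩ := QGHA.algEquiv_h_eq_aeval hq hf' φ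
  obtain ⟨a, ha, b, rfl⟩ := natDegree_eq_one.1 hp
  have hh : φ (QGHA.h q f g) = a • QGHA.h q f g + algebraMap F _ b := by
    simp [hφ, Algebra.smul_def]
  obtain ⟨lam, hlam, hx⟩ := QGHA.algEquiv_x_eq_smul hq hf' φ
  obtain ⟨mu, hmu, hy⟩ := QGHA.algEquiv_y_eq_smul hq hf' φ
  refine ⟨?_, ⟨a, b, ha, hh⟩, lam, mu, hlam, hmu, hx, hy⟩
  rw [AlgHom.map_adjoin, Set.image_singleton, ← QGHA.adjoin_smul_h_add ha b, ← hh]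
  rfl
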